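/- For every n ≥ 3, the permutation L' ∘ L of the (finite) set of Dyck n-paths has order exactly 2n. -/

import Mathlib

/-- A Dyck path, encoded as a list of steps: `true` = upstep `u`, `false` = downstep `d`. -/
def IsDyck (p : List Bool) : Prop :=
  p.count true = p.count false ∧ ∀ q : List Bool, q <+: p → q.count false ≤ q.count true

/-- A Dyck `n`-path: a Dyck path with `n` upsteps (and `n` downsteps). -/
def IsDyckN (n : ℕ) (p : List Bool) : Prop := IsDyck p ∧ p.count true = n

/-- The (0-indexed) positions `j` such that step `j` is `a` and step `j+1` is `b`. -/
def adjPositions (a b : Bool) (p : List Bool) : List ℕ :=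
  (List.range p.length).filter (fun j => p[j]? == some a && p[j+1]? == some b)

/-- Labels of the first downstep of each occurrence of `dd` (downsteps labelled left to
right by 1, 2, …). -/
def lkA (p : List Bool) : List ℕ :=
  (adjPositions false false p).map (fun j => (p.take (j+1)).count false)

/-- Labels of the first upstep of each occurrence of `uu` (upsteps labelled left to
right by 1, 2, …). -/
def lkD (p : List Bool) : List ℕ :=
  (adjPositions true true p).map (fun j => (p.take (j+1)).count true)

/-- The Dyck path of size `n` whose partial-sum ascent-descent code is `(A, D)`:
its ascent lengths are the successive differences of `A ++ [n]`, and its descent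
lengths are the successive differences of `D ++ [n]`. -/
def pathOfCode (n : ℕ) (A D : List ℕ) : List Bool :=
  let A' := A ++ [n]
  let D' := D ++ [n]
  let a := List.zipWith (· - ·) A' (0 :: A')
  let d := List.zipWith (· - ·) D' (0 :: D')
  (List.zipWith (fun x y => List.replicate x true ++ List.replicate y false) a d).flatten

/-- The Lalanne–Kreweras involution `L` on Dyck paths: the image is the Dyck path
whose partial-sum ascent-descent code is `(lkA p, lkD p)`. -/
def Lmap (p : List Bool) : List Bool := pathOfCode (p.count true) (lkA p) (lkD p)

/-- The length of the first component of a Dyck path (the first return to ground level). -/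
def firstReturn (p : List Bool) : ℕ :=
  match (List.range' 1 p.length).find? (fun j => (p.take j).count true == (p.take j).count false) with
  | some j => j
  | none => p.length

def componentsAux : ℕ → List Bool → List (List Bool)
  | 0, _ => []
  | _, [] => []
  | fuel+1, p =>
      let j := max 1 (firstReturn p)
      p.take j :: componentsAux fuel (p.drop j)

/-- The decomposition of a Dyck path into its components (elevated Dyck paths). -/
def components (p : List Bool) : List (List Bool) := componentsAux p.length p

/-- The derivative `F'` of a map `F` on Dyck paths: each component `u Q d` is replaced
by `u (F Q) d`. -/
def pathDeriv (F : List Bool → List Bool) (p : List Bool) : List Bool :=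
  ((components p).map (fun c => true :: (F ((c.drop 1).dropLast) ++ [false]))).flatten

/-- Walks from height `h` down to height `0` that never go below `0`. -/
def IsWalk : ℕ → List Bool → Prop
  | h, [] => h = 0
  | h, true :: p => IsWalk (h + 1) p
  | 0, false :: _ => False
  | h + 1, false :: p => IsWalk h p

theorem isWalk_iff (p : List Bool) : ∀ h : ℕ, IsWalk h p ↔
    p.count true + h = p.count false ∧
      ∀ q : List Bool, q <+: p → q.count false ≤ q.count true + h := by
  induction p with
  | nil => intro h; simp [IsWalk]
  | cons b p ih =>
    intro h
    cases b
    · cases h with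
      | zero =>
        simp only [IsWalk, false_iff]
        rintro ⟨-, h⟩
        have := h [false] (by simp)
        simp at this
      | succ h =>
        simp only [IsWalk, ih, List.prefix_cons_iff]
        constructor
        · rintro ⟨h1, h2⟩
          refine ⟨by simp; omega, ?_⟩
          rintro q (rfl | ⟨t, rfl, ht⟩)
          · simp
          · have := h2 t ht
            simp; omega
        · rintro ⟨h1, h2⟩
          refine ⟨by simp at h1; omega, fun q hq => ?_⟩
          have := h2 (false :: q) (Or.inr ⟨q, rfl, hq⟩)
          simp at this; omega
    · simp only [IsWalk, ih, List.prefix_cons_iff]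
      constructor
      · rintro ⟨h1, h2⟩
        refine ⟨by simp; omega, ?_⟩
        rintro q (rfl | ⟨t, rfl, ht⟩)
        · simp
        · have := h2 t ht
          simp; omega
      · rintro ⟨h1, h2⟩
        refine ⟨by simp at h1; omega, fun q hq => ?_⟩
        have := h2 (true :: q) (Or.inr ⟨q, rfl, hq⟩)
        simp at this; omega

theorem isDyck_iff_isWalk (p : List Bool) : IsDyck p ↔ IsWalk 0 p := by
  simp [isWalk_iff, IsDyck]

/-- Dyck paths generated by the first-return decomposition. -/
inductive DyckTree : List Bool → Prop
  | nil : DyckTree []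
  | node {q r : List Bool} : DyckTree q → DyckTree r → DyckTree (true :: q ++ false :: r)

theorem DyckTree.isWalk_append {q : List Bool} (hq : DyckTree q) :
    ∀ (h : ℕ) (r : List Bool), IsWalk h (q ++ r) ↔ IsWalk h r := by
  induction hq with
  | nil => simp
  | node _ _ ih1 ih2 => intro h r; simp [IsWalk, ih1, ih2]

/-- Concatenations of `k + 1` Dyck paths separated by `k` downsteps. -/
def DyckForest : ℕ → List Bool → Prop
  | 0, p => DyckTree p
  | k + 1, p => ∃ q r, p = q ++ false :: r ∧ DyckTree q ∧ DyckForest k r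

theorem IsWalk.dyckForest {p : List Bool} : ∀ {h : ℕ}, IsWalk h p → DyckForest h p := by
  induction p with
  | nil => rintro h rfl; exact .nil
  | cons b p ih =>
    intro h hp
    cases b
    · cases h with
      | zero => exact hp.elim
      | succ h => exact ⟨[], p, rfl, .nil, ih hp⟩
    · obtain ⟨q, r, rfl, hq, hr⟩ := ih (h := h + 1) hp
      cases h with
      | zero => exact .node hq hr
      | succ h =>
        obtain ⟨q', r', rfl, hq', hr'⟩ := hr
        exact ⟨true :: q ++ false :: q', r', by simp, .node hq hq', hr'⟩

theorem isDyck_iff_dyckTree (p : List Bool) : IsDyck p ↔ DyckTree p := by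
  rw [isDyck_iff_isWalk]
  refine ⟨fun h => h.dyckForest, fun h => ?_⟩
  have := h.isWalk_append 0 []
  simpa [IsWalk] using this

theorem DyckTree.count_eq {p : List Bool} (h : DyckTree p) : p.count true = p.count false :=
  ((isDyck_iff_dyckTree p).2 h).1

/-- For each step `c`, whether it is followed by another `c`. -/
def sameNext (c : Bool) : List Bool → List Bool
  | [] => []
  | x :: p => if x = c then decide (p.head? = some c) :: sameNext c p else sameNext c p

/-- For each downstep, whether it is preceded by another downstep; the argument tells whether
the step before the list is a downstep. -/
def samePrev : Bool → List Bool → List Bool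
  | _, [] => []
  | _, true :: p => samePrev false p
  | b, false :: p => b :: samePrev true p

/-- The positions of `true`, counted from `s + 1`. -/
def truePos : ℕ → List Bool → List ℕ
  | _, [] => []
  | s, b :: l => if b then (s + 1) :: truePos (s + 1) l else truePos (s + 1) l

theorem adjPositions_cons (c x : Bool) (p : List Bool) :
    adjPositions c c (x :: p) =
      (if x = c ∧ p.head? = some c then [0] else []) ++ (adjPositions c c p).map (· + 1) := by
  unfold adjPositions
  rw [List.length_cons, List.range_succ_eq_map, List.filter_cons, List.filter_map]
  have h0 : (x :: p)[0 + 1]? = p.head? := by simp [List.head?_eq_getElem?]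
  rw [h0]
  by_cases h : x = c ∧ p.head? = some c
  · simp [h, Function.comp_def]
  · have : ((x :: p)[0]? == some c && p.head? == some c) = false := by
      simpa [not_and] using h
    rw [this]
    simp [h, Function.comp_def]

theorem map_count_adjPositions (c : Bool) (p : List Bool) : ∀ s : ℕ,
    (adjPositions c c p).map (fun j => s + (p.take (j + 1)).count c) =
      truePos s (sameNext c p) := by
  induction p with
  | nil => intro s; simp [adjPositions, sameNext, truePos]
  | cons x p ih =>
    intro s
    rw [adjPositions_cons]
    by_cases hx : x = c
    · subst hx
      have := ih (s + 1)
      simp only [sameNext, if_true, truePos, List.map_append, List.map_map, Function.comp_def,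
        ← this]
      by_cases h : p.head? = some x
      · simp [h]; intros; omega
      · simp [h]; intros; omega
    · simp [sameNext, hx, ← ih, Function.comp_def]

theorem lkA_eq (p : List Bool) : lkA p = truePos 0 (sameNext false p) := by
  simp [lkA, ← map_count_adjPositions]

theorem lkD_eq (p : List Bool) : lkD p = truePos 0 (sameNext true p) := by
  simp [lkD, ← map_count_adjPositions]

theorem length_sameNext (c : Bool) (p : List Bool) : (sameNext c p).length = p.count c := by
  induction p with
  | nil => rfl
  | cons x p ih => by_cases h : x = c <;> simp [sameNext, h, ih]

theorem length_samePrev (p : List Bool) : ∀ b, (samePrev b p).length = p.count false := by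
  induction p with
  | nil => simp [samePrev]
  | cons x p ih => intro b; cases x <;> simp [samePrev, ih]

theorem sameNext_true_append (q r : List Bool) :
    sameNext true (q ++ false :: r) = sameNext true q ++ sameNext true r := by
  induction q with
  | nil => simp [sameNext]
  | cons x q ih => cases x <;> cases q <;> simp_all [sameNext]

theorem DyckTree.head? {p : List Bool} (h : DyckTree p) : p = [] ∨ p.head? = some true := by
  cases h <;> simp

theorem DyckTree.samePrev_append {q : List Bool} (hq : DyckTree q) (r : List Bool) :
    samePrev false (q ++ r) = samePrev false q ++ samePrev (decide (q ≠ [])) r := by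
  induction hq generalizing r with
  | nil => simp [samePrev]
  | @node q r' _ h2 ih1 ih2 =>
    have h3 : ∀ l, samePrev true (r' ++ l) = samePrev false r' ++ samePrev true l := by
      intro l
      rcases r' with _ | ⟨_ | _, r'⟩
      · rfl
      · simpa using h2.head?
      · have := ih2 l
        simpa [samePrev] using this
    have h4 : samePrev true r' = samePrev false r' := by simpa [samePrev] using h3 []
    simp [samePrev, ih1, h3, h4]

theorem DyckTree.samePrev_true {r : List Bool} (h : DyckTree r) :
    samePrev true r = samePrev false r := by
  cases h <;> simp [samePrev]

theorem sameNext_node {q : List Bool} (hq : DyckTree q) (r : List Bool) :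
    sameNext true (true :: q ++ false :: r) =
      decide (q ≠ []) :: sameNext true q ++ sameNext true r := by
  have h := sameNext_true_append q r
  rcases hq.head? with rfl | h1
  · simp [sameNext]
  · rcases q with _ | ⟨x, q⟩
    · simp at h1
    · simp only [List.head?_cons, Option.some.injEq] at h1
      subst h1
      rw [List.cons_append, sameNext, h]; simp

theorem samePrev_node {q r : List Bool} (hq : DyckTree q) (hr : DyckTree r) :
    samePrev false (true :: q ++ false :: r) =
      samePrev false q ++ decide (q ≠ []) :: samePrev false r := by
  simp [samePrev, hq.samePrev_append, hr.samePrev_true]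

theorem DyckTree.sameNext_samePrev {p : List Bool} (h : DyckTree p) (hp : p ≠ []) :
    samePrev false p ++ [false] = false :: sameNext false p := by
  have key : ∀ p : List Bool, ∀ b, p.getLast? = some false →
      samePrev b p ++ [false] = (b && decide (p.head? = some false)) :: sameNext false p := by
    intro p
    induction p with
    | nil => simp
    | cons x p ih =>
      intro b hl
      rcases p with _ | ⟨y, p⟩
      · simp at hl; subst hl; simp [samePrev, sameNext]
      · have hl' : (y :: p).getLast? = some false := by simpa using hl
        cases x
        · simp only [samePrev, List.cons_append, ih true hl', sameNext]
          simp
        · simp only [samePrev, ih false hl', sameNext]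
          simp
  have hl : p.getLast? = some false := by
    clear key
    induction h with
    | nil => simp at hp
    | @node q r _ _ _ ih =>
      by_cases hr : r = []
      · rw [hr, List.getLast?_append]; simp
      · rw [List.getLast?_append, List.getLast?_cons, ih hr]; simp
  simpa using key p false hl

theorem DyckTree.sameNext_true_last {p : List Bool} (h : DyckTree p) (hp : p ≠ []) :
    ∃ l, sameNext true p = l ++ [false] := by
  induction h with
  | nil => simp at hp
  | @node q r hq _ ihq ihr =>
    rw [sameNext_node hq]
    by_cases hr : r = []
    · subst hr
      by_cases hq : q = []
      · subst hq; exact ⟨[], by simp [sameNext]⟩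
      · obtain ⟨l, hl⟩ := ihq hq
        exact ⟨true :: l, by simp [hl, sameNext, hq]⟩
    · obtain ⟨l, hl⟩ := ihr hr
      exact ⟨decide (q ≠ []) :: sameNext true q ++ l, by simp [hl]⟩

theorem eq_of_sameNext_eq {p : List Bool} : ∀ {q : List Bool}, p.head? = q.head? →
    (∀ c, sameNext c p = sameNext c q) → p = q := by
  induction p with
  | nil => intro q h _; cases q <;> simp_all
  | cons x p ih =>
    intro q h hs
    rcases q with _ | ⟨y, q⟩
    · simp at h
    obtain rfl : x = y := by simpa using h
    have h1 : decide (p.head? = some x) = decide (q.head? = some x) := by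
      have := hs x
      simp only [sameNext, if_true, List.cons.injEq] at this
      exact this.1
    have h2 : ∀ c, sameNext c p = sameNext c q := by
      intro c
      have := hs c
      by_cases hc : x = c
      · simp only [sameNext, hc, if_true, List.cons.injEq] at this
        exact this.2
      · simpa only [sameNext, hc, if_false] using this
    have h3 : p.length = q.length := by
      have ht := congrArg List.length (h2 true)
      have hf := congrArg List.length (h2 false)
      simp only [length_sameNext] at ht hf
      rw [← List.count_true_add_count_false p, ← List.count_true_add_count_false q, ht, hf]
    have h4 : p.head? = q.head? := by
      rcases p with _ | ⟨a, p⟩ <;> rcases q with _ | ⟨b, q⟩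
      · rfl
      · simp at h3
      · simp at h3
      · cases a <;> cases b <;> cases x <;> simp_all
    rw [ih h4 h2]

theorem sameNext_replicate_append (c : Bool) (x : ℕ) (r : List Bool) (hr : r.head? ≠ some c) :
    sameNext c (List.replicate (x + 1) c ++ r) =
      List.replicate x true ++ false :: sameNext c r := by
  induction x with
  | zero => simp [sameNext, hr]
  | succ x ih =>
    rw [List.replicate_succ, List.cons_append, sameNext, if_pos rfl, ih]
    simp [List.replicate_succ]

theorem sameNext_replicate_append_of_ne {b c : Bool} (h : b ≠ c) (x : ℕ) (r : List Bool) :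
    sameNext c (List.replicate x b ++ r) = sameNext c r := by
  induction x with
  | zero => rfl
  | succ x ih => simp [List.replicate_succ, sameNext, h, ih]

/-- The path with ascent lengths `X` and descent lengths `Y`. -/
def blockPath (X Y : List ℕ) : List Bool :=
  (List.zipWith (fun x y => List.replicate x true ++ List.replicate y false) X Y).flatten

/-- Successive differences, starting from `s`. -/
def diffs (s : ℕ) (l : List ℕ) : List ℕ := List.zipWith (· - ·) l (s :: l)

theorem diffs_cons (s x : ℕ) (l : List ℕ) : diffs s (x :: l) = (x - s) :: diffs x l := by
  simp [diffs]

theorem blockPath_cons (x y : ℕ) (X Y : List ℕ) : blockPath (x :: X) (y :: Y) =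
    List.replicate x true ++ (List.replicate y false ++ blockPath X Y) := by
  simp [blockPath]

/-- The bits of runs of the given lengths: each run of length `x` gives `x - 1` times `true` and
then `false`. -/
def runBits (X : List ℕ) : List Bool :=
  X.flatMap fun x => List.replicate (x - 1) true ++ [false]

theorem head?_blockPath {X Y : List ℕ} (hX : ∀ x ∈ X, 0 < x) (h : X.length = Y.length) :
    (blockPath X Y).head? ≠ some false := by
  rcases X with _ | ⟨x, X⟩
  · simp [blockPath]
  rcases Y with _ | ⟨y, Y⟩
  · simp at h
  obtain ⟨x, rfl⟩ : ∃ z, x = z + 1 := ⟨x - 1, by have := hX x (by simp); omega⟩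
  simp [blockPath_cons, List.replicate_succ]

theorem sameNext_blockPath {X Y : List ℕ} (hX : ∀ x ∈ X, 0 < x) (hY : ∀ y ∈ Y, 0 < y)
    (h : X.length = Y.length) :
    sameNext true (blockPath X Y) = runBits X ∧ sameNext false (blockPath X Y) = runBits Y := by
  induction X generalizing Y with
  | nil => rcases Y with _ | _ <;> simp_all [blockPath, runBits, sameNext]
  | cons x X ih =>
    rcases Y with _ | ⟨y, Y⟩
    · simp at h
    obtain ⟨x, rfl⟩ : ∃ z, x = z + 1 := ⟨x - 1, by have := hX x (by simp); omega⟩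
    obtain ⟨y, rfl⟩ : ∃ z, y = z + 1 := ⟨y - 1, by have := hY y (by simp); omega⟩
    have hX' : ∀ x ∈ X, 0 < x := fun z hz => hX z (by simp [hz])
    have hY' : ∀ x ∈ Y, 0 < x := fun z hz => hY z (by simp [hz])
    have h' : X.length = Y.length := by simpa using h
    obtain ⟨h1, h2⟩ := ih hX' hY' h'
    rw [blockPath_cons]
    constructor
    · rw [sameNext_replicate_append _ _ _ (by simp [List.replicate_succ]),
        sameNext_replicate_append_of_ne (by simp), h1]
      simp [runBits]
    · rw [sameNext_replicate_append_of_ne (by simp),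
        sameNext_replicate_append _ _ _ (head?_blockPath hX' h'), h2]
      simp [runBits]

theorem lt_of_mem_truePos {l : List Bool} : ∀ {s x : ℕ}, x ∈ truePos s l → s < x := by
  induction l with
  | nil => simp [truePos]
  | cons b l ih =>
    intro s x hx
    cases b
    · have := ih (s := s + 1) (x := x) (by simpa [truePos] using hx); omega
    · rcases (by simpa [truePos] using hx : x = s + 1 ∨ x ∈ truePos (s + 1) l) with h | h
      · omega
      · have := ih h; omega

theorem pairwise_truePos (l : List Bool) : ∀ s, (s :: truePos s l).Pairwise (· < ·) := by
  induction l with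
  | nil => simp [truePos]
  | cons b l ih =>
    intro s
    refine List.pairwise_cons.2 ⟨fun x hx => lt_of_mem_truePos hx, ?_⟩
    cases b
    · simpa [truePos] using (List.pairwise_cons.1 (ih (s + 1))).2
    · simpa [truePos] using ih (s + 1)

theorem truePos_append (l m : List Bool) : ∀ s,
    truePos s (l ++ m) = truePos s l ++ truePos (s + l.length) m := by
  induction l with
  | nil => simp [truePos]
  | cons b l ih =>
    intro s
    have : s + 1 + l.length = s + (l.length + 1) := by omega
    cases b <;> simp [truePos, ih, this]

theorem runBits_diffs_truePos (l : List Bool) : ∀ s,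
    runBits (diffs s (truePos s (l ++ [true]))) = (l ++ [true]).map (!·) := by
  induction l with
  | nil => simp [truePos, diffs, runBits]
  | cons b l ih =>
    intro s
    have h := ih (s + 1)
    cases b
    · simp only [List.cons_append, truePos, Bool.false_eq_true, if_false]
      obtain ⟨x, L, hL⟩ : ∃ x L, truePos (s + 1) (l ++ [true]) = x :: L := by
        rcases e : truePos (s + 1) (l ++ [true]) with _ | ⟨x, L⟩
        · simp [truePos_append, truePos] at e
        · exact ⟨x, L, rfl⟩
      have hx : s + 1 < x := lt_of_mem_truePos (l := l ++ [true]) (by simp [hL])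
      rw [hL] at h ⊢
      rw [diffs_cons] at h ⊢
      have e : x - s - 1 = (x - (s + 1) - 1) + 1 := by omega
      simp only [runBits, List.flatMap_cons] at h ⊢
      rw [e, List.replicate_succ, List.cons_append, List.cons_append, h]
      simp
    · simp only [List.cons_append, truePos, if_true, diffs_cons]
      simp only [runBits, List.flatMap_cons] at h ⊢
      rw [h]; simp

theorem pos_of_mem_diffs {l : List ℕ} : ∀ {s x : ℕ}, (s :: l).Pairwise (· < ·) →
    x ∈ diffs s l → 0 < x := by
  induction l with
  | nil => simp [diffs]
  | cons y l ih =>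
    intro s x h hx
    rw [diffs_cons, List.mem_cons] at hx
    rcases hx with rfl | hx
    · have := (List.pairwise_cons.1 h).1 y (by simp); omega
    · exact ih (List.pairwise_cons.1 h).2 hx

theorem isWalk_replicate_true (x h : ℕ) (r : List Bool) :
    IsWalk h (List.replicate x true ++ r) ↔ IsWalk (h + x) r := by
  induction x generalizing h with
  | zero => rfl
  | succ x ih =>
    rw [List.replicate_succ, List.cons_append, IsWalk, ih]
    rw [show h + 1 + x = h + (x + 1) by omega]

theorem isWalk_replicate_false (x h : ℕ) (r : List Bool) (hr : IsWalk h r) :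
    IsWalk (h + x) (List.replicate x false ++ r) := by
  induction x with
  | zero => exact hr
  | succ x ih => exact ih

theorem isWalk_blockPath_diffs {A D : List ℕ} (h : List.Forall₂ (· ≤ ·) D A) :
    ∀ {s t : ℕ}, t ≤ s → (s :: A).Pairwise (· < ·) → (t :: D).Pairwise (· < ·) →
      (s :: A).getLast? = (t :: D).getLast? →
      IsWalk (s - t) (blockPath (diffs s A) (diffs t D)) := by
  induction h with
  | nil => intro s t _ _ _ h; simp at h; simp [blockPath, diffs, IsWalk, h]
  | @cons y x D A hxy _ ih =>
    intro s t hst hA hD hl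
    rw [diffs_cons, diffs_cons, blockPath_cons, isWalk_replicate_true]
    have h1 := (List.pairwise_cons.1 hA).1 x (by simp)
    have h2 := (List.pairwise_cons.1 hD).1 y (by simp)
    rw [show s - t + (x - s) = (x - y) + (y - t) by omega]
    refine isWalk_replicate_false _ _ _
      (ih hxy (List.pairwise_cons.1 hA).2 (List.pairwise_cons.1 hD).2 ?_)
    simpa using hl

theorem forall₂_truePos {b : List Bool} : ∀ {c : List Bool} {Q : List ℕ} {s : ℕ},
    b.length = c.length → (∀ x ∈ Q, x ≤ s) →
    (∀ i, (b.take i).count true ≤ Q.length + (c.take i).count true) →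
    b.count true = Q.length + c.count true →
    List.Forall₂ (· ≤ ·) (Q ++ truePos s c) (truePos s b) := by
  induction b with
  | nil =>
    intro c Q s h _ _ h3
    obtain rfl : c = [] := by simpa using h.symm
    obtain rfl : Q = [] := by simpa using h3.symm
    simp [truePos]
  | cons y b ih =>
    intro c Q s h hQ h2 h3
    rcases c with _ | ⟨x, c⟩
    · simp at h
    have step : truePos s (x :: c) = (if x then [s + 1] else []) ++ truePos (s + 1) c := by
      cases x <;> simp [truePos]
    rw [step, ← List.append_assoc]
    have hQ' : ∀ z ∈ Q ++ (if x then [s + 1] else []), z ≤ s + 1 := by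
      intro z hz
      rcases List.mem_append.1 hz with hz | hz
      · have := hQ z hz; omega
      · cases x <;> simp_all
    have hl : ∀ i, ((x :: c).take (i + 1)).count true + Q.length =
        (Q ++ (if x then [s + 1] else [])).length + (c.take i).count true := by
      intro i; cases x <;> simp <;> omega
    have hl' : (x :: c).count true + Q.length =
        (Q ++ (if x then [s + 1] else [])).length + c.count true := by
      cases x <;> simp <;> omega
    generalize Q ++ (if x then [s + 1] else []) = Q' at *
    cases y
    · simp only [truePos, Bool.false_eq_true, if_false]
      refine ih (by simpa using h) hQ' (fun i => ?_) ?_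
      · have a := h2 (i + 1); have b := hl i
        simp at a b ⊢; omega
      · simp at h3 hl' ⊢; omega
    · rcases Q' with _ | ⟨z, Q'⟩
      · have a := h2 (0 + 1); have b := hl 0
        simp only [List.take_succ_cons, List.take_zero, List.count_cons_self, List.count_nil,
          List.length_nil] at a b
        omega
      · simp only [truePos, if_true, List.cons_append]
        refine .cons (hQ' z (by simp)) (ih (by simpa using h)
          (fun w hw => hQ' w (by simp [hw])) (fun i => ?_) ?_)
        · have a := h2 (i + 1); have b := hl i
          simp at a b ⊢; omega
        · simp at h3 hl' ⊢; omega

theorem length_truePos (l : List Bool) : ∀ s, (truePos s l).length = l.count true := by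
  induction l with
  | nil => simp [truePos]
  | cons b l ih => intro s; cases b <;> simp [truePos, ih]

theorem length_diffs (s : ℕ) (l : List ℕ) : (diffs s l).length = l.length := by
  simp [diffs]

theorem count_take_succ_le (l : List Bool) (i : ℕ) :
    (l.take (i + 1)).count true ≤ (l.take i).count true + 1 := by
  rw [List.take_add_one, List.count_append]
  rcases l[i]? with _ | b
  · simp
  · cases b <;> simp

theorem DyckTree.count_samePrev {p : List Bool} (h : DyckTree p) :
    (sameNext true p).count true = (samePrev false p).count true ∧
    ∀ i < p.count true, ((samePrev false p).take (i + 1)).count true ≤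
      ((sameNext true p).take i).count true := by
  induction h with
  | nil => simp [sameNext, samePrev]
  | @node q r hq hr ihq ihr =>
    obtain ⟨q1, q2⟩ := ihq
    obtain ⟨r1, r2⟩ := ihr
    have lu := length_sameNext true q
    have le := length_samePrev q false
    rw [← hq.count_eq] at le
    rw [sameNext_node hq, samePrev_node hq hr]
    generalize sameNext true q = uq at *
    generalize samePrev false q = eq at *
    generalize sameNext true r = ur at *
    generalize samePrev false r = er at *
    refine ⟨by simp [List.count_cons]; omega, fun i hi => ?_⟩
    have hc : (true :: q ++ false :: r).count true = q.count true + r.count true + 1 := by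
      simp
    rw [hc] at hi
    rcases Nat.lt_trichotomy i (q.count true) with h | h | h
    · have hne : q ≠ [] := by rintro rfl; simp at h
      rw [List.take_append_of_le_length (by omega)]
      rcases i with _ | i
      · have := q2 0 h; simpa using this
      · have a := q2 i (by omega)
        have b := count_take_succ_le eq (i + 1)
        rw [List.cons_append, List.take_succ_cons, List.take_append_of_le_length (by omega)]
        simp [hne]; omega
    · have e1 : (eq ++ decide (q ≠ []) :: er).take (i + 1) = eq ++ [decide (q ≠ [])] := by
        rw [List.take_append, List.take_of_length_le (by omega), le, h]; simp
      rw [e1]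
      by_cases hne : q = []
      · subst hne
        obtain rfl : eq = [] := by simpa using le
        simp
      · rcases i with _ | i
        · exfalso
          cases hq with
          | nil => exact hne rfl
          | node => simp at h
        · have a := q2 i (by omega)
          rw [List.take_of_length_le (by omega)] at a
          rw [List.cons_append, List.take_succ_cons, List.take_append_of_le_length (by omega)]
          simp [hne]; omega
    · obtain ⟨j, rfl⟩ : ∃ j, i = q.count true + 1 + j := ⟨i - q.count true - 1, by omega⟩
      have a := r2 j (by omega)
      have e1 : (eq ++ decide (q ≠ []) :: er).take (q.count true + 1 + j + 1) =
          eq ++ decide (q ≠ []) :: er.take (j + 1) := by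
        rw [List.take_append, List.take_of_length_le (by omega), le,
          show q.count true + 1 + j + 1 - q.count true = (j + 1) + 1 by omega]
        simp
      have e2 : (decide (q ≠ []) :: uq ++ ur).take (q.count true + 1 + j) =
          decide (q ≠ []) :: uq ++ ur.take j := by
        rw [List.take_append, List.take_of_length_le (by simp; omega), List.length_cons, lu,
          show q.count true + 1 + j - (q.count true + 1) = j by omega]
      rw [e1, e2]
      simp [List.count_cons]; omega

theorem DyckTree.bits_Lmap {p : List Bool} (h : DyckTree p) (hp : p ≠ []) :
    DyckTree (Lmap p) ∧ (Lmap p).count true = p.count true ∧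
    sameNext true (Lmap p) = (samePrev false p).tail.map (!·) ++ [false] ∧
    samePrev false (Lmap p) = false :: (sameNext true p).dropLast.map (!·) := by
  obtain ⟨c, hc⟩ := h.sameNext_true_last hp
  have he := h.sameNext_samePrev hp
  obtain ⟨b, hb⟩ : ∃ b, samePrev false p = false :: b := by
    rcases e : samePrev false p with _ | ⟨x, b⟩
    · rw [e] at he
      have := congrArg List.length he
      simp [length_sameNext, ← h.count_eq] at this
      cases h <;> simp_all
    · rw [e] at he; simp at he; exact ⟨b, by rw [he.1]⟩
  have hb' : sameNext false p = b ++ [false] := by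
    rw [hb] at he; simpa using he.symm
  have lb : b.length + 1 = p.count true := by
    rw [h.count_eq, ← length_sameNext, hb']; simp
  have lc : c.length + 1 = p.count true := by
    rw [← length_sameNext, hc]; simp
  have hA : truePos 0 (sameNext false p) ++ [p.count true] = truePos 0 (b ++ [true]) := by
    simp [hb', truePos_append, truePos, lb]
  have hD : truePos 0 (sameNext true p) ++ [p.count true] = truePos 0 (c ++ [true]) := by
    simp [hc, truePos_append, truePos, lc]
  have hL : Lmap p =
      blockPath (diffs 0 (truePos 0 (b ++ [true]))) (diffs 0 (truePos 0 (c ++ [true]))) := by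
    rw [Lmap, pathOfCode, lkA_eq, lkD_eq, hA, hD]; rfl
  obtain ⟨k1, k2⟩ := h.count_samePrev
  have hcount : (b ++ [true]).count true = (c ++ [true]).count true := by
    rw [hc, hb] at k1; simp at k1 ⊢; omega
  have hF : List.Forall₂ (· ≤ ·) (truePos 0 (c ++ [true])) (truePos 0 (b ++ [true])) := by
    refine forall₂_truePos (Q := []) (by simp; omega) (by simp) (fun i => ?_) (by simpa using hcount)
    by_cases hi : i < p.count true
    · have := k2 i hi
      rw [hb, hc, List.take_succ_cons, List.take_append_of_le_length (by omega)] at this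
      rw [List.take_append_of_le_length (by omega), List.take_append_of_le_length (by omega)]
      simpa using this
    · rw [List.take_of_length_le (by simp; omega), List.take_of_length_le (by simp; omega)]
      omega
  have pA := pairwise_truePos (b ++ [true]) 0
  have pD := pairwise_truePos (c ++ [true]) 0
  have hW : IsWalk 0 (Lmap p) := by
    rw [hL]
    refine isWalk_blockPath_diffs hF le_rfl pA pD ?_
    rw [← hA, ← hD, List.getLast?_cons, List.getLast?_cons]; simp
  have hT : DyckTree (Lmap p) := hW.dyckForest
  obtain ⟨s1, s2⟩ := sameNext_blockPath (X := diffs 0 (truePos 0 (b ++ [true])))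
    (Y := diffs 0 (truePos 0 (c ++ [true]))) (fun x hx => pos_of_mem_diffs pA hx)
    (fun x hx => pos_of_mem_diffs pD hx) (by simp [length_diffs, length_truePos]; simpa using hcount)
  rw [← hL, runBits_diffs_truePos] at s1 s2
  have hn : (Lmap p).count true = p.count true := by
    rw [← length_sameNext, s1]; simp [lb]
  refine ⟨hT, hn, ?_, ?_⟩
  · rw [s1, hb]; simp
  · have hne : Lmap p ≠ [] := by intro h0; rw [h0] at hn; simp at hn; omega
    have := hT.sameNext_samePrev hne
    rw [s2] at this
    rw [hc]
    simp only [List.map_append, List.map_cons, Bool.not_true, List.map_nil,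
      ← List.cons_append] at this
    simpa using (List.append_inj_left' this rfl)

theorem firstReturn_node {q : List Bool} (hq : DyckTree q) (r : List Bool) :
    firstReturn (true :: q ++ false :: r) = q.length + 2 := by
  have key : (List.range' 1 (true :: q ++ false :: r).length).find? (fun j =>
      ((true :: q ++ false :: r).take j).count true ==
        ((true :: q ++ false :: r).take j).count false) = some (q.length + 2) := by
    rw [List.find?_range'_eq_some]
    have hl : (true :: q ++ false :: r).length = q.length + r.length + 2 := by simp; omega
    refine ⟨?_, ?_, ?_⟩
    · have : (true :: q ++ false :: r).take (q.length + 2) = true :: q ++ [false] := by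
        simp [List.take_append]
      rw [this]; simp [hq.count_eq]
    · rw [List.mem_range'_1]; omega
    · intro j h1 h2
      obtain ⟨j, rfl⟩ : ∃ i, j = i + 1 := ⟨j - 1, by omega⟩
      have : (true :: q ++ false :: r).take (j + 1) = true :: q.take j := by
        simp [List.take_append]; omega
      rw [this]
      have := ((isDyck_iff_dyckTree q).2 hq).2 _ (List.take_prefix j q)
      simp; omega
  rw [firstReturn, key]

theorem componentsAux_eq_of_le {p : List Bool} (hp : DyckTree p) : ∀ {k : ℕ}, p.length ≤ k →
    componentsAux k p = components p := by
  suffices h : ∀ k l, p.length ≤ k → p.length ≤ l → componentsAux k p = componentsAux l p from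
    fun {k} hk => h k _ hk le_rfl
  induction hp with
  | nil => intro k l _ _; cases k <;> cases l <;> rfl
  | @node q r hq hr _ ih =>
    intro k l hk hl
    simp at hk hl
    obtain ⟨k, rfl⟩ : ∃ i, k = i + 1 := ⟨k - 1, by omega⟩
    obtain ⟨l, rfl⟩ : ∃ i, l = i + 1 := ⟨l - 1, by omega⟩
    have := firstReturn_node hq r
    rw [List.cons_append] at this ⊢
    rw [componentsAux, componentsAux, this]
    · simp only [show max 1 (q.length + 2) = q.length + 2 by omega]
      have e : (true :: (q ++ false :: r)).drop (q.length + 2) = r := by simp [List.drop_append]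
      rw [e, ih k l (by omega) (by omega)]
    all_goals simp

theorem pathDeriv_node (F : List Bool → List Bool) {q r : List Bool} (hq : DyckTree q)
    (hr : DyckTree r) : pathDeriv F (true :: q ++ false :: r) =
      true :: F q ++ false :: pathDeriv F r := by
  have h : components (true :: q ++ false :: r) = (true :: q ++ [false]) :: components r := by
    have := firstReturn_node hq r
    rw [List.cons_append] at this ⊢
    rw [components, List.length_cons, componentsAux, this]
    · simp only [show max 1 (q.length + 2) = q.length + 2 by omega]
      have e : (true :: (q ++ false :: r)).drop (q.length + 2) = r := by simp [List.drop_append]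
      rw [e, componentsAux_eq_of_le hr (by simp; omega)]
      simp [List.take_append]
    all_goals simp
  rw [pathDeriv, h]
  simp [pathDeriv]

/-- Position `i` carries a component `ud`, in terms of the bits `u` of the upsteps and `e` of the
downsteps. -/
def IsHill (u e : List Bool) (i : ℕ) : Prop :=
  u.getD i true = false ∧ e.getD i true = false ∧ (u.take i).count true = (e.take i).count true

/-- The effect of the derivative of the Lalanne–Kreweras map on bits: complement and swap,
except on components `ud`. -/
structure DerivBits (u e u' e' : List Bool) : Prop where
  length_e : e.length = u.length
  length_u' : u'.length = u.length
  length_e' : e'.length = u.length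
  count_eq : u.count true = e.count true
  up : ∀ i < u.length, (u'.getD i true = false ↔ e.getD i true = true ∨ IsHill u e i)
  down : ∀ i < u.length, (e'.getD i true = false ↔ u.getD i true = true ∨ IsHill u e i)

theorem isHill_append_left {u e : List Bool} (v f : List Bool) (h : e.length = u.length) {i : ℕ}
    (hi : i < u.length) : IsHill (u ++ v) (e ++ f) i ↔ IsHill u e i := by
  unfold IsHill
  rw [List.getD_append _ _ _ _ hi, List.getD_append _ _ _ _ (by omega),
    List.take_append_of_le_length hi.le, List.take_append_of_le_length (by omega)]

theorem isHill_append_right {u e : List Bool} (v f : List Bool) (h : e.length = u.length)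
    (hc : u.count true = e.count true) (j : ℕ) :
    IsHill (u ++ v) (e ++ f) (u.length + j) ↔ IsHill v f j := by
  unfold IsHill
  rw [List.getD_append_right _ _ _ _ (by omega), List.getD_append_right _ _ _ _ (by omega), h,
    Nat.add_sub_cancel_left]
  have h1 : (u ++ v).take (u.length + j) = u ++ v.take j := by
    rw [List.take_length_add_append]
  have h2 : (e ++ f).take (u.length + j) = e ++ f.take j := by
    rw [← h, List.take_length_add_append]
  rw [h1, h2, List.count_append, List.count_append, hc, Nat.add_left_cancel_iff]

theorem DerivBits.append {u e u' e' v f v' f' : List Bool} (h : DerivBits u e u' e')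
    (k : DerivBits v f v' f') : DerivBits (u ++ v) (e ++ f) (u' ++ v') (e' ++ f') where
  length_e := by simp [h.length_e, k.length_e]
  length_u' := by simp [h.length_u', k.length_u']
  length_e' := by simp [h.length_e', k.length_e']
  count_eq := by simp [h.count_eq, k.count_eq]
  up i hi := by
    have := h.length_e; have := h.length_u'
    by_cases hi' : i < u.length
    · rw [isHill_append_left _ _ h.length_e hi', List.getD_append _ _ _ _ (by omega),
        List.getD_append _ _ _ _ (by omega), h.up i hi']
    · obtain ⟨j, rfl⟩ : ∃ j, i = u.length + j := ⟨i - u.length, by omega⟩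
      rw [isHill_append_right _ _ h.length_e h.count_eq, List.getD_append_right _ _ _ _ (by omega),
        List.getD_append_right _ _ _ _ (by omega), h.length_e, h.length_u', Nat.add_sub_cancel_left,
        k.up j (by simp at hi; omega)]
  down i hi := by
    have := h.length_e; have := h.length_e'
    by_cases hi' : i < u.length
    · rw [isHill_append_left _ _ h.length_e hi', List.getD_append _ _ _ _ (by omega),
        List.getD_append _ _ _ _ (by omega), h.down i hi']
    · obtain ⟨j, rfl⟩ : ∃ j, i = u.length + j := ⟨i - u.length, by omega⟩
      rw [isHill_append_right _ _ h.length_e h.count_eq, List.getD_append_right _ _ _ _ (by omega),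
        List.getD_append_right _ _ _ _ (by omega), h.length_e', Nat.add_sub_cancel_left,
        k.down j (by simp at hi; omega)]

theorem derivBits_hill : DerivBits [false] [false] [false] [false] := by
  refine ⟨rfl, rfl, rfl, rfl, ?_, ?_⟩ <;> intro i hi <;> simp at hi <;> subst hi <;> simp [IsHill]

theorem derivBits_elevated {u e : List Bool} (h : e.length = u.length)
    (hc : (true :: u).count true = (e ++ [true]).count true)
    (hu : ∀ i < u.length, (e.take (i + 1)).count true ≤ (u.take i).count true) :
    DerivBits (true :: u) (e ++ [true]) ((e ++ [true]).map (!·)) ((true :: u).map (!·)) := by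
  have hh : ∀ i < (true :: u).length, ¬ IsHill (true :: u) (e ++ [true]) i := by
    rintro (_ | i) hi ⟨h1, _, h3⟩
    · simp at h1
    · simp only [List.length_cons, Nat.add_lt_add_iff_right] at hi
      have := hu i hi
      rw [List.take_append_of_le_length (by omega)] at h3
      simp at h3
      omega
  refine ⟨by simp [h], by simp [h], by simp, hc, ?_, ?_⟩ <;> intro i hi
  · have : i < (e ++ [true]).length := by simp at hi ⊢; omega
    simp only [hh i hi, or_false]
    rw [List.getD_eq_getElem _ _ (by simpa using this), List.getD_eq_getElem _ _ this,
      List.getElem_map, Bool.not_eq_false']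
  · simp only [hh i hi, or_false]
    rw [List.getD_eq_getElem _ _ (by simpa using hi), List.getD_eq_getElem _ _ hi,
      List.getElem_map, Bool.not_eq_false']

theorem DyckTree.bits_pathDeriv_Lmap {p : List Bool} (h : DyckTree p) :
    DyckTree (pathDeriv Lmap p) ∧ (pathDeriv Lmap p).count true = p.count true ∧
    DerivBits (sameNext true p) (samePrev false p) (sameNext true (pathDeriv Lmap p))
      (samePrev false (pathDeriv Lmap p)) := by
  induction h with
  | nil =>
    refine ⟨.nil, rfl, ?_⟩
    have : pathDeriv Lmap [] = [] := rfl
    rw [this]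
    constructor <;> simp [sameNext, samePrev]
  | @node q r hq hr _ ih =>
    obtain ⟨d, c, b⟩ := ih
    rw [pathDeriv_node _ hq hr]
    by_cases hne : q = []
    · subst hne
      have hL : Lmap [] = [] := rfl
      rw [hL]
      refine ⟨.node .nil d, by simp [c], ?_⟩
      rw [sameNext_node .nil, sameNext_node .nil, samePrev_node .nil hr, samePrev_node .nil d]
      exact derivBits_hill.append b
    · obtain ⟨l1, l2, l3, l4⟩ := hq.bits_Lmap hne
      refine ⟨.node l1 d, by simp [c, l2], ?_⟩
      have hne' : Lmap q ≠ [] := by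
        intro h0
        rw [h0] at l2
        cases hq <;> simp_all
      rw [sameNext_node hq, sameNext_node l1, samePrev_node hq hr, samePrev_node l1 d, l3, l4]
      simp only [ne_eq, hne, hne', not_false_eq_true, decide_true]
      have len : (samePrev false q).length = (sameNext true q).length := by
        rw [length_sameNext, length_samePrev, hq.count_eq]
      obtain ⟨k1, k2⟩ := hq.count_samePrev
      have := (derivBits_elevated len (by simp; omega)
        (by rwa [length_sameNext])).append b
      obtain ⟨v, hv⟩ := hq.sameNext_true_last hne
      obtain ⟨w, hw⟩ : ∃ w, samePrev false q = false :: w := by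
        have he := hq.sameNext_samePrev hne
        rcases e : samePrev false q with _ | ⟨x, b⟩
        · rw [e, hv] at len; simp at len
        · rw [e] at he; simp at he; exact ⟨b, by rw [he.1]⟩
      rw [hv, hw] at this ⊢
      simpa using this

/-- A noncrossing partial matching of the points of `[lo, hi]`, written as an involution whose
fixed points are the unmatched points; no unmatched point lies below an arc. -/
structure PartialMatching (lo hi : ℤ) (f : ℤ → ℤ) : Prop where
  invol : ∀ k, f (f k) = k
  outside : ∀ k, k < lo ∨ hi < k → f k = k
  nc : ∀ a b, a < b → b < f a → a < f b ∧ f b < f a ∧ f b ≠ b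

/-- The unmatched points of `[lo, hi]`. -/
noncomputable def unmatched (lo hi : ℤ) (f : ℤ → ℤ) : Finset ℤ :=
  (Finset.Icc lo hi).filter fun k => f k = k

theorem mem_unmatched {lo hi : ℤ} {f : ℤ → ℤ} {k : ℤ} :
    k ∈ unmatched lo hi f ↔ (lo ≤ k ∧ k ≤ hi) ∧ f k = k := by
  simp [unmatched]

theorem PartialMatching.mirror {lo hi : ℤ} {f : ℤ → ℤ} (h : PartialMatching lo hi f) :
    PartialMatching (-hi) (-lo) (fun k => -f (-k)) where
  invol k := by simp [h.invol]
  outside k hk := by rw [h.outside (-k) (by omega)]; ring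
  nc a b hab hb := by
    have h1 := h.nc (f (-a)) (-b) (by omega) (by rw [h.invol]; omega)
    rw [h.invol] at h1
    omega

theorem card_unmatched_mirror (lo hi : ℤ) (f : ℤ → ℤ) :
    (unmatched (-hi) (-lo) (fun k => -f (-k))).card = (unmatched lo hi f).card := by
  refine Finset.card_bij (fun k _ => -k) ?_ ?_ ?_
  · intro k hk
    rw [mem_unmatched] at hk ⊢
    omega
  · intro a _ b _ h
    omega
  · intro b hb
    refine ⟨-b, ?_, by simp⟩
    rw [mem_unmatched] at hb ⊢
    simp only [neg_neg]
    omega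

theorem PartialMatching.open_right {lo hi : ℤ} {f : ℤ → ℤ} (h : PartialMatching lo hi f)
    (hle : lo ≤ hi + 1) : PartialMatching lo (hi + 1) f ∧
      (unmatched lo (hi + 1) f).card = (unmatched lo hi f).card + 1 := by
  refine ⟨⟨h.invol, fun k hk => h.outside k (by omega), h.nc⟩, ?_⟩
  have : unmatched lo (hi + 1) f = insert (hi + 1) (unmatched lo hi f) := by
    ext k
    have := h.outside (hi + 1) (by omega)
    simp only [Finset.mem_insert, mem_unmatched]
    constructor
    · rintro ⟨h1, h2⟩
      by_cases hk : k = hi + 1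
      · exact Or.inl hk
      · exact Or.inr ⟨by omega, h2⟩
    · rintro (rfl | ⟨h1, h2⟩)
      · exact ⟨by omega, this⟩
      · exact ⟨by omega, h2⟩
  rw [this, Finset.card_insert_of_notMem (by rw [mem_unmatched]; omega)]

theorem PartialMatching.close_right {lo hi : ℤ} {f : ℤ → ℤ} (h : PartialMatching lo hi f)
    (hne : (unmatched lo hi f).Nonempty) : ∃ g m, PartialMatching lo (hi + 1) g ∧
      (unmatched lo (hi + 1) g).card + 1 = (unmatched lo hi f).card ∧
      m ∈ unmatched lo hi f ∧ (∀ k ∈ unmatched lo hi f, k ≤ m) ∧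
      g m = hi + 1 ∧ g (hi + 1) = m ∧ ∀ k, k ≠ m → k ≠ hi + 1 → g k = f k := by
  obtain ⟨m, hm, hmax⟩ := (unmatched lo hi f).exists_max_image id hne
  simp only [id] at hmax
  have hm' := mem_unmatched.1 hm
  have hout := h.outside (hi + 1) (by omega)
  have hfm : ∀ k, f k = m → k = m := fun k hk => by rw [← h.invol k, hk, hm'.2]
  have hfh : ∀ k, f k = hi + 1 → k = hi + 1 := fun k hk => by rw [← h.invol k, hk, hout]
  set g : ℤ → ℤ := fun k => if k = m then hi + 1 else if k = hi + 1 then m else f k with hg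
  have g1 : g m = hi + 1 := by simp [hg]
  have g2 : g (hi + 1) = m := by
    have : hi + 1 ≠ m := by omega
    simp [hg, this]
  have g3 : ∀ k, k ≠ m → k ≠ hi + 1 → g k = f k := fun k h1 h2 => by simp [hg, h1, h2]
  clear_value g
  have hP : PartialMatching lo (hi + 1) g := by
    refine ⟨fun k => ?_, fun k hk => ?_, fun a b hab hb => ?_⟩
    · by_cases h1 : k = m
      · rw [h1, g1, g2]
      by_cases h2 : k = hi + 1
      · rw [h2, g2, g1]
      rw [g3 k h1 h2, g3 _ (fun h => h1 (hfm k h)) (fun h => h2 (hfh k h)), h.invol]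
    · rw [g3 k (by omega) (by omega), h.outside k (by omega)]
    · by_cases h1 : a = m
      · subst h1
        rw [g1] at hb ⊢
        rw [g3 b (by omega) (by omega)]
        have hfb : f b ≠ b := fun hfb => by
          have := hmax b (mem_unmatched.2 ⟨by omega, hfb⟩)
          omega
        have hle : f b < hi + 1 := by
          by_contra hc
          have := h.outside (f b) (by omega)
          rw [h.invol] at this
          exact hfb this.symm
        refine ⟨?_, hle, hfb⟩
        by_contra hc
        have h0 : f b ≠ a := fun hh => by have := hfm b hh; omega
        have := h.nc (f b) a (by omega) (by rw [h.invol]; omega)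
        exact this.2.2 hm'.2
      by_cases h2 : a = hi + 1
      · rw [h2, g2] at hb; omega
      rw [g3 a h1 h2] at hb ⊢
      have k := h.nc a b hab hb
      have hb1 : b ≠ m := fun hh => k.2.2 (by rw [hh, hm'.2])
      have hb2 : b ≠ hi + 1 := fun hh => k.2.2 (by rw [hh, hout])
      rw [g3 b hb1 hb2]
      exact k
  refine ⟨g, m, hP, ?_, hm, hmax, g1, g2, g3⟩
  have : unmatched lo (hi + 1) g = (unmatched lo hi f).erase m := by
    ext k
    simp only [Finset.mem_erase, mem_unmatched]
    constructor
    · rintro ⟨h1, h2⟩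
      have e1 : k ≠ m := by rintro rfl; omega
      have e2 : k ≠ hi + 1 := by rintro rfl; omega
      rw [g3 k e1 e2] at h2
      exact ⟨e1, by omega, h2⟩
    · rintro ⟨e1, h1, h2⟩
      exact ⟨by omega, by rw [g3 k e1 (by omega), h2]⟩
  rw [this, Finset.card_erase_of_mem hm]
  have := Finset.card_pos.2 hne
  omega

theorem PartialMatching.open_left {lo hi : ℤ} {f : ℤ → ℤ} (h : PartialMatching lo hi f)
    (hle : lo - 1 ≤ hi) : PartialMatching (lo - 1) hi f ∧
      (unmatched (lo - 1) hi f).card = (unmatched lo hi f).card + 1 := by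
  obtain ⟨h1, h2⟩ := h.mirror.open_right (by omega)
  have e : (fun k => -(fun k => -f (-k)) (-k)) = f := by ext k; simp
  have h3 := h1.mirror
  have h4 := card_unmatched_mirror (-hi) (-lo + 1) (fun k => -f (-k))
  rw [e, show -(-lo + 1) = lo - 1 by ring, neg_neg] at h3 h4
  exact ⟨h3, by rw [h4, h2, card_unmatched_mirror]⟩

theorem PartialMatching.close_left {lo hi : ℤ} {f : ℤ → ℤ} (h : PartialMatching lo hi f)
    (hne : (unmatched lo hi f).Nonempty) : ∃ g m, PartialMatching (lo - 1) hi g ∧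
      (unmatched (lo - 1) hi g).card + 1 = (unmatched lo hi f).card ∧
      m ∈ unmatched lo hi f ∧ (∀ k ∈ unmatched lo hi f, m ≤ k) ∧
      g m = lo - 1 ∧ g (lo - 1) = m ∧ ∀ k, k ≠ m → k ≠ lo - 1 → g k = f k := by
  have hc := card_unmatched_mirror lo hi f
  obtain ⟨g, m, h1, h2, h3, h4, h5, h6, h7⟩ :=
    h.mirror.close_right (Finset.card_pos.1 (by rw [hc]; exact Finset.card_pos.2 hne))
  have h1' := h1.mirror
  have hc' := card_unmatched_mirror (-hi) (-lo + 1) g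
  rw [show -(-lo + 1) = lo - 1 by ring, neg_neg] at h1' hc'
  refine ⟨_, -m, h1', by rw [hc', h2, hc], ?_, fun k hk => ?_, by simp [h5]; ring, ?_, ?_⟩
  · rw [mem_unmatched] at h3 ⊢; omega
  · rw [mem_unmatched] at hk
    have := h4 (-k) (mem_unmatched.2 ⟨by omega, by simp [hk.2]⟩)
    omega
  · rw [show -(lo - 1) = -lo + 1 by ring, h6]
  · intro k hk1 hk2
    rw [h7 (-k) (by omega) (by omega)]; simp

/-- A partial matching of `[1 - i, i]` in which `i + 1` looks left exactly where `u` is `false`,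
and `-i` looks right exactly where `e` is `false`. -/
structure PartialCode (u e : List Bool) (i : ℕ) (f : ℤ → ℤ) : Prop where
  matching : PartialMatching (1 - i) i f
  card : (unmatched (1 - i) i f).card + 2 * (e.take i).count true = 2 * (u.take i).count true
  up : ∀ j < i, (u.getD j true = false ↔ |f (j + 1)| < |(j + 1 : ℤ)|)
  down : ∀ j < i, (e.getD j true = true ↔ |f (-j)| < |(-j : ℤ)|)

theorem count_take_succ_getD {l : List Bool} {i : ℕ} (h : i < l.length) :
    ((l.take (i + 1)).count true = (l.take i).count true + 1 ∧ l.getD i true = true) ∨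
    ((l.take (i + 1)).count true = (l.take i).count true ∧ l.getD i true = false) := by
  rw [List.take_add_one, List.getElem?_eq_getElem h, List.count_append,
    List.getD_eq_getElem _ _ h]
  cases l[i] <;> simp

theorem exists_partialCode {u e : List Bool} (h : e.length = u.length)
    (hu : ∀ i < u.length, (e.take (i + 1)).count true ≤ (u.take i).count true) :
    ∀ i ≤ u.length, ∃ f, PartialCode u e i f := by
  intro i
  induction i with
  | zero =>
    intro _
    refine ⟨id, ⟨by simp, by simp, ?_⟩, ?_, by simp, by simp⟩
    · intro a b h1 h2; simp at h2; omega
    · simp [unmatched]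
  | succ i ih =>
    intro hi
    obtain ⟨f, hf⟩ := ih (by omega)
    have hle := hu i (by omega)
    have hcard := hf.card
    -- the point `-i`
    obtain ⟨g, g1, g2, g3, g4⟩ : ∃ g, PartialMatching (-i) i g ∧
        (unmatched (-i) i g).card + 2 * (e.take (i + 1)).count true =
          2 * (u.take i).count true + 1 ∧
        (e.getD i true = true ↔ |g (-i)| < |(-i : ℤ)|) ∧
        ∀ k : ℤ, 1 - i ≤ k → k ≤ i → (|g k| < |k| ↔ |f k| < |k|) := by
      rcases count_take_succ_getD (l := e) (i := i) (by omega) with ⟨c, d⟩ | ⟨c, d⟩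
      · have h2 : 1 < (unmatched (1 - i) i f).card := by omega
        obtain ⟨g, m, g1, g2, g3, g4, g5, g6, g7⟩ :=
          hf.matching.close_left (Finset.card_pos.1 (by omega))
        obtain ⟨x, hx, y, hy, hxy⟩ := Finset.one_lt_card.1 h2
        have hx1 := g4 x hx
        have hy1 := g4 y hy
        rw [mem_unmatched] at g3 hx hy
        have e1 : (1 - i - 1 : ℤ) = -i := by ring
        rw [e1] at g1 g2 g5 g6 g7
        have hm : |m| < i := abs_lt.2 (by omega)
        refine ⟨g, g1, by omega, ?_, fun k h1 h2 => ?_⟩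
        · rw [d, g6, abs_neg, Nat.abs_cast]; simpa using hm
        · by_cases hk : k = m
          · subst hk
            rw [g5, g3.2, abs_neg, Nat.abs_cast]
            constructor <;> intro <;> omega
          · rw [g7 k hk (by omega)]
      · obtain ⟨g1, g2⟩ := hf.matching.open_left (by omega)
        have e1 : (1 - i - 1 : ℤ) = -i := by ring
        rw [e1] at g1 g2
        refine ⟨f, g1, by omega, ?_, fun k _ _ => Iff.rfl⟩
        rw [d, hf.matching.outside (-i) (by omega)]
        simp
    -- the point `i + 1`
    obtain ⟨q, q1, q2, q3, q4⟩ : ∃ q, PartialMatching (-i) (i + 1) q ∧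
        (unmatched (-i) (i + 1) q).card + 2 * (e.take (i + 1)).count true =
          2 * (u.take (i + 1)).count true ∧
        (u.getD i true = false ↔ |q (i + 1)| < |(i + 1 : ℤ)|) ∧
        ∀ k : ℤ, -i ≤ k → k ≤ i → (|q k| < |k| ↔ |g k| < |k|) := by
      have habs : |(i + 1 : ℤ)| = i + 1 := abs_of_nonneg (by omega)
      rcases count_take_succ_getD (l := u) (i := i) (by omega) with ⟨c, d⟩ | ⟨c, d⟩
      · obtain ⟨q1, q2⟩ := g1.open_right (by omega)
        refine ⟨g, q1, by omega, ?_, fun k _ _ => Iff.rfl⟩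
        rw [d, g1.outside (i + 1) (by omega)]
        simp
      · obtain ⟨q, m, q1, q2, q3, q4, q5, q6, q7⟩ :=
          g1.close_right (Finset.card_pos.1 (by omega))
        rw [mem_unmatched] at q3
        have hm : |m| < i + 1 := abs_lt.2 (by omega)
        refine ⟨q, q1, by omega, ?_, fun k h1 h2 => ?_⟩
        · rw [d, q6, habs]; simpa using hm
        · by_cases hk : k = m
          · subst hk
            rw [q5, q3.2, habs]
            constructor <;> intro <;> omega
          · rw [q7 k hk (by omega)]
    refine ⟨q, by push_cast; rwa [show (1 - (i + 1) : ℤ) = -i by ring], ?_, ?_, ?_⟩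
    · push_cast; rwa [show (1 - (i + 1) : ℤ) = -i by ring]
    · intro j hj
      by_cases hji : j = i
      · subst hji; exact q3
      · rw [hf.up j (by omega), q4 _ (by omega) (by omega), g4 _ (by omega) (by omega)]
    · intro j hj
      by_cases hji : j = i
      · subst hji; rw [g3, q4 _ (by omega) (by omega)]
      · rw [hf.down j (by omega), q4 _ (by omega) (by omega), g4 _ (by omega) (by omega)]

/-- A noncrossing perfect matching of the points of `[1 - n, n]`. -/
structure NCMatching (n : ℕ) (f : ℤ → ℤ) : Prop where
  mem : ∀ k, 1 - (n : ℤ) ≤ k → k ≤ n → 1 - (n : ℤ) ≤ f k ∧ f k ≤ n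
  invol : ∀ k, 1 - (n : ℤ) ≤ k → k ≤ n → f (f k) = k
  ne : ∀ k, 1 - (n : ℤ) ≤ k → k ≤ n → f k ≠ k
  nc : ∀ a b, 1 - (n : ℤ) ≤ a → f a ≤ n → a < b → b < f a → a < f b ∧ f b < f a

theorem even_card_of_involution {s : Finset ℤ} (f : ℤ → ℤ) (hmem : ∀ k ∈ s, f k ∈ s)
    (hinv : ∀ k ∈ s, f (f k) = k) (hne : ∀ k ∈ s, f k ≠ k) : Even s.card := by
  have h : ∑ _k ∈ s, (1 : ZMod 2) = 0 :=
    Finset.sum_involution (fun k _ => f k) (fun _ _ => by decide) (fun k hk _ => hne k hk)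
      (fun k hk => hmem k hk) (fun k hk => hinv k hk)
  rw [Finset.sum_const, nsmul_eq_mul, mul_one] at h
  exact (ZMod.natCast_eq_zero_iff_even).1 h

theorem NCMatching.odd_sub {n : ℕ} {f : ℤ → ℤ} (h : NCMatching n f) {k : ℤ}
    (h1 : 1 - (n : ℤ) ≤ k) (h2 : k ≤ n) : (f k - k) % 2 = 1 := by
  have key : ∀ a, 1 - (n : ℤ) ≤ a → f a ≤ n → a < f a → (f a - a) % 2 = 1 := by
    intro a ha hfa hlt
    have he : Even (Finset.Ioo a (f a)).card := by
      refine even_card_of_involution f ?_ ?_ ?_ <;> intro k hk <;> rw [Finset.mem_Ioo] at hk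
      · exact Finset.mem_Ioo.2 (h.nc a k ha hfa hk.1 hk.2)
      · exact h.invol k (by omega) (by omega)
      · exact h.ne k (by omega) (by omega)
    rw [Int.card_Ioo] at he
    obtain ⟨c, hc⟩ := he
    omega
  have hm := h.mem k h1 h2
  rcases lt_trichotomy k (f k) with hlt | heq | hgt
  · exact key k h1 hm.2 hlt
  · exact absurd heq.symm (h.ne k h1 h2)
  · have := key (f k) hm.1 (by rw [h.invol k h1 h2]; exact h2) (by rw [h.invol k h1 h2]; exact hgt)
    rw [h.invol k h1 h2] at this
    omega

/-- The bits `u` and `e` record which points `i + 1` and `-i` of the matching `f` are matched to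
a point of smaller absolute value. -/
structure MatchingBits (n : ℕ) (f : ℤ → ℤ) (u e : List Bool) : Prop where
  matching : NCMatching n f
  length_u : u.length = n
  length_e : e.length = n
  up : ∀ i < n, (u.getD i true = false ↔ -(i + 1 : ℤ) < f (i + 1) ∧ f (i + 1) < i + 1)
  down : ∀ i < n, (e.getD i true = true ↔ -(i : ℤ) < f (-i) ∧ f (-i) < i)

theorem PartialCode.matchingBits {u e : List Bool} {f : ℤ → ℤ} (h : PartialCode u e u.length f)
    (hlen : e.length = u.length) (hc : u.count true = e.count true) :
    MatchingBits u.length f u e := by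
  have hcard : (unmatched (1 - (u.length : ℤ)) u.length f).card = 0 := by
    have := h.card
    rw [List.take_length, ← hlen, List.take_length, hlen] at this
    omega
  have hne : ∀ k, 1 - (u.length : ℤ) ≤ k → k ≤ u.length → f k ≠ k := by
    intro k h1 h2 h3
    rw [Finset.card_eq_zero] at hcard
    have : k ∈ unmatched (1 - (u.length : ℤ)) u.length f := mem_unmatched.2 ⟨⟨h1, h2⟩, h3⟩
    simp [hcard] at this
  have hinv := h.matching.invol
  refine ⟨⟨?_, fun k _ _ => hinv k, hne, ?_⟩, rfl, hlen, ?_, ?_⟩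
  · intro k h1 h2
    by_contra hcon
    have h3 := h.matching.outside (f k) (by omega)
    rw [hinv] at h3
    exact hne k h1 h2 h3.symm
  · intro a b _ _ hab hb
    have := h.matching.nc a b hab hb
    exact ⟨this.1, this.2.1⟩
  · intro i hi
    rw [h.up i hi, abs_lt, abs_of_nonneg (by positivity)]
  · intro i hi
    rw [h.down i hi, abs_lt, abs_neg, abs_of_nonneg (by positivity)]

theorem DyckTree.exists_matchingBits {p : List Bool} (h : DyckTree p) :
    ∃ f, MatchingBits (p.count true) f (sameNext true p) (samePrev false p) := by
  have hu : (sameNext true p).length = p.count true := length_sameNext true p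
  have he : (samePrev false p).length = p.count true := by
    rw [length_samePrev, h.count_eq]
  have hlen : (samePrev false p).length = (sameNext true p).length := by rw [hu, he]
  have hcs := h.count_samePrev
  obtain ⟨f, hf⟩ := exists_partialCode hlen (fun i hi => hcs.2 i (hu ▸ hi)) _ le_rfl
  exact ⟨f, hu ▸ hf.matchingBits hlen hcs.1⟩

theorem MatchingBits.closers {n : ℕ} {f : ℤ → ℤ} {u e : List Bool} (h : MatchingBits n f u e)
    (i : ℕ) (hi : i ≤ n) :
    ((Finset.Icc (1 - (i : ℤ)) i).filter fun k => |f k| < |k|).card + (u.take i).count true =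
      i + (e.take i).count true := by
  induction i with
  | zero => simp
  | succ i ih =>
    have ih := ih (by omega)
    have hcu := count_take_succ_getD (l := u) (i := i) (by rw [h.length_u]; omega)
    have hce := count_take_succ_getD (l := e) (i := i) (by rw [h.length_e]; omega)
    have hI : Finset.Icc (1 - ((i + 1 : ℕ) : ℤ)) (i + 1 : ℕ) =
        insert (-(i : ℤ)) (insert (i + 1 : ℤ) (Finset.Icc (1 - (i : ℤ)) i)) := by
      ext k
      simp only [Finset.mem_insert, Finset.mem_Icc]
      omega
    have hup : (|f (i + 1)| < |(i + 1 : ℤ)|) ↔ u.getD i true = false := by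
      rw [h.up i (by omega), abs_lt, abs_of_nonneg (by positivity)]
    have hdown : (|f (-i)| < |(-i : ℤ)|) ↔ e.getD i true = true := by
      rw [h.down i (by omega), abs_lt, abs_neg, abs_of_nonneg (by positivity)]
    rw [hI, Finset.filter_insert, Finset.filter_insert]
    simp only [hup, hdown]
    have hn1 : (i + 1 : ℤ) ∉ (Finset.Icc (1 - (i : ℤ)) i).filter fun k => |f k| < |k| := by
      simp
    have hn2 : (-i : ℤ) ∉ (Finset.Icc (1 - (i : ℤ)) i).filter fun k => |f k| < |k| := by
      simp
    have hn3 : (-i : ℤ) ∉ insert (i + 1 : ℤ)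
        ((Finset.Icc (1 - (i : ℤ)) i).filter fun k => |f k| < |k|) := by
      rw [Finset.mem_insert, not_or]
      exact ⟨by omega, hn2⟩
    rcases hcu with ⟨hcu, hu⟩ | ⟨hcu, hu⟩ <;> rcases hce with ⟨hce, he⟩ | ⟨hce, he⟩ <;>
      simp only [hcu, hce, hu, he, Bool.true_eq_false, Bool.false_eq_true, if_true, if_false,
        Finset.card_insert_of_notMem hn1, Finset.card_insert_of_notMem hn2,
        Finset.card_insert_of_notMem hn3] <;> omega

theorem MatchingBits.balanced_iff {n : ℕ} {f : ℤ → ℤ} {u e : List Bool}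
    (h : MatchingBits n f u e) {i : ℕ} (hi : i ≤ n) :
    (u.take i).count true = (e.take i).count true ↔
      ∀ k, 1 - (i : ℤ) ≤ k → k ≤ i → 1 - (i : ℤ) ≤ f k ∧ f k ≤ i := by
  classical
  have hcl := h.closers i hi
  set I := Finset.Icc (1 - (i : ℤ)) i with hI
  have hmemI : ∀ k, k ∈ I ↔ 1 - (i : ℤ) ≤ k ∧ k ≤ i := fun k => Finset.mem_Icc
  have hinv : ∀ k ∈ I, f (f k) = k := fun k hk => by
    rw [hmemI] at hk
    exact h.matching.invol k (by omega) (by omega)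
  have hcardI : I.card = 2 * i := by
    rw [hI, Int.card_Icc]
    omega
  have hsplit := Finset.card_filter_add_card_filter_not (s := I) (fun k => |f k| < |k|)
  set C := I.filter fun k => |f k| < |k| with hC
  set O := I.filter fun k => ¬ |f k| < |k| with hO
  have hsub : C.image f ⊆ O := by
    intro x hx
    rw [Finset.mem_image] at hx
    obtain ⟨k, hk, rfl⟩ := hx
    rw [hC, Finset.mem_filter] at hk
    rw [hO, Finset.mem_filter, hmemI, hinv k hk.1]
    rw [hmemI] at hk
    have hk2 := hk.2
    rw [abs_lt] at hk2
    refine ⟨?_, not_lt.2 hk.2.le⟩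
    rcases abs_cases k with hk3 | hk3 <;> omega
  have himg : (C.image f).card = C.card := by
    refine Finset.card_image_of_injOn ?_
    intro a ha b hb hab
    have ha' := hinv a (Finset.mem_filter.1 ha).1
    have hb' := hinv b (Finset.mem_filter.1 hb).1
    rw [← ha', ← hb', hab]
  constructor
  · intro hbal k hk1 hk2
    have hk : k ∈ I := (hmemI k).2 ⟨hk1, hk2⟩
    have heq : C.image f = O := Finset.eq_of_subset_of_card_le hsub (by omega)
    by_cases hkc : |f k| < |k|
    · rw [← hmemI]
      have : f k ∈ C.image f := Finset.mem_image_of_mem f (Finset.mem_filter.2 ⟨hk, hkc⟩)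
      exact (Finset.mem_filter.1 (hsub this)).1
    · have : k ∈ C.image f := heq ▸ Finset.mem_filter.2 ⟨hk, hkc⟩
      obtain ⟨x, hx, rfl⟩ := Finset.mem_image.1 this
      have hxI := (Finset.mem_filter.1 hx).1
      rw [hinv x hxI]
      exact (hmemI x).1 hxI
  · intro hclosed
    have hle : O ⊆ C.image f := by
      intro k hk
      obtain ⟨hkI, hkn⟩ := Finset.mem_filter.1 hk
      refine Finset.mem_image.2 ⟨f k, Finset.mem_filter.2 ⟨?_, ?_⟩, hinv k hkI⟩
      · rw [hmemI] at hkI ⊢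
        exact hclosed k hkI.1 hkI.2
      · rw [hinv k hkI]
        refine lt_of_le_of_ne (not_lt.1 hkn) fun habs => ?_
        rw [hmemI] at hkI
        have hodd := h.matching.odd_sub (k := k) (by omega) (by omega)
        rcases abs_eq_abs.1 habs with h1 | h1 <;> omega
    have := Finset.card_le_card hle
    have := Finset.card_le_card hsub
    omega

theorem MatchingBits.isHill_iff {n : ℕ} {f : ℤ → ℤ} {u e : List Bool}
    (h : MatchingBits n f u e) {i : ℕ} (hi : i < n) :
    IsHill u e i ↔ f (-i) = i + 1 := by
  have hM := h.matching
  have hup := h.up i hi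
  have hdown := h.down i hi
  have hbal := h.balanced_iff hi.le
  have hi1 := hM.invol (-i) (by omega) (by omega)
  have hi2 := hM.invol (i + 1) (by omega) (by omega)
  constructor
  · rintro ⟨h1, h2, h3⟩
    rw [hup] at h1
    rw [hbal] at h3
    by_contra hne
    have h4 : f (i + 1) ≠ -i := fun h5 => hne (by rw [← h5, hi2])
    have h6 := h3 (f (i + 1)) (by omega) (by omega)
    rw [hi2] at h6
    omega
  · intro h1
    rw [h1] at hi1
    refine ⟨hup.2 (by omega), ?_, hbal.2 ?_⟩
    · rw [← Bool.not_eq_true, hdown]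
      omega
    · intro k hk1 hk2
      have := hM.nc (-i) k (by omega) (by omega) (by omega) (by omega)
      omega

theorem MatchingBits.deriv {n : ℕ} {f : ℤ → ℤ} {u e u' e' : List Bool}
    (h : MatchingBits n f u e) (hd : DerivBits u e u' e') :
    MatchingBits n (fun k => 1 - f (1 - k)) u' e' := by
  have hM := h.matching
  have hlen := h.length_u
  have hmem := hM.mem
  refine ⟨⟨?_, ?_, ?_, ?_⟩, ?_, ?_, ?_, ?_⟩
  · intro k h1 h2
    have := hmem (1 - k) (by omega) (by omega)
    omega
  · intro k h1 h2
    have := hM.invol (1 - k) (by omega) (by omega)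
    simp [this]
  · intro k h1 h2 h3
    exact hM.ne (1 - k) (by omega) (by omega) (by omega)
  · intro a b h1 h2 h3 h4
    have ha := hM.mem (1 - a) (by omega) (by omega)
    have hi := hM.invol (1 - a) (by omega) (by omega)
    have := hM.nc (f (1 - a)) (1 - b) (by omega) (by omega) (by omega) (by omega)
    omega
  · rw [hd.length_u', hlen]
  · rw [hd.length_e', hlen]
  · intro i hi
    rw [hd.up i (by omega), h.isHill_iff hi, h.down i hi]
    have hodd := hM.odd_sub (k := -i) (by omega) (by omega)
    rw [show (1 - ((i : ℤ) + 1)) = -i by ring]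
    omega
  · intro i hi
    rw [← Bool.not_eq_false, hd.down i (by omega), h.isHill_iff hi, ← Bool.not_eq_false, h.up i hi]
    have hodd := hM.odd_sub (k := i + 1) (by omega) (by omega)
    have hiff : f (-i) = i + 1 ↔ f (i + 1) = -i :=
      ⟨fun hh => by rw [← hh, hM.invol (-i) (by omega) (by omega)],
        fun hh => by rw [← hh, hM.invol (i + 1) (by omega) (by omega)]⟩
    rw [hiff, show (1 - -(i : ℤ)) = i + 1 by ring]
    omega

/-- The reflection of the `2 n`-cycle `[1 - n, n]` fixing `0` and `n`. -/
def reflect (n : ℕ) (k : ℤ) : ℤ := if k = n then n else -k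

theorem MatchingBits.lk {n : ℕ} {f : ℤ → ℤ} {u e : List Bool} (h : MatchingBits n f u e)
    (hn : 1 ≤ n) : MatchingBits n (fun k => reflect n (f (reflect n k)))
      (e.tail.map (!·) ++ [false]) (false :: u.dropLast.map (!·)) := by
  have hM := h.matching
  have hmem : ∀ k, 1 - (n : ℤ) ≤ k → k ≤ n → 1 - (n : ℤ) ≤ reflect n k ∧ reflect n k ≤ n := by
    intro k h1 h2
    unfold reflect
    split_ifs <;> omega
  have hinv : ∀ k, 1 - (n : ℤ) ≤ k → k ≤ n → reflect n (reflect n k) = k := by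
    intro k h1 h2
    unfold reflect
    split_ifs <;> omega
  have hu := h.length_u
  have he := h.length_e
  refine ⟨⟨?_, ?_, ?_, ?_⟩, by simp [he]; omega, by simp [hu]; omega, ?_, ?_⟩
  · intro k h1 h2
    have h3 := hmem k h1 h2
    have h4 := hM.mem _ h3.1 h3.2
    exact hmem _ h4.1 h4.2
  · intro k h1 h2
    have h3 := hmem k h1 h2
    have h4 := hM.mem _ h3.1 h3.2
    rw [hinv _ h4.1 h4.2, hM.invol _ h3.1 h3.2, hinv k h1 h2]
  · intro k h1 h2 h3
    have h4 := hmem k h1 h2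
    have h5 := hM.mem _ h4.1 h4.2
    refine hM.ne _ h4.1 h4.2 ?_
    rw [← hinv _ h5.1 h5.2, h3]
  · intro a b h1 h2 h3 h4
    have ha : reflect n a = -a := if_neg (by omega)
    have hb : reflect n b = -b := if_neg (by omega)
    rw [ha] at h2 h4 ⊢
    rw [hb]
    have hma := hM.mem (-a) (by omega) (by omega)
    have hmb := hM.mem (-b) (by omega) (by omega)
    have hia := hM.invol (-a) (by omega) (by omega)
    have hib := hM.invol (-b) (by omega) (by omega)
    by_cases hfa : f (-a) = n
    · have h5 : f (-b) ≠ n := fun h6 => by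
        rw [h6] at hib
        rw [hfa] at hia
        omega
      have h7 : f (-b) < -a := by
        by_contra hcon
        have h8 : f (-b) ≠ -a := fun h6 => by
          rw [h6] at hib
          omega
        have := hM.nc (-a) (f (-b)) (by omega) (by omega) (by omega) (by omega)
        omega
      simp only [reflect, hfa, if_true, if_neg h5]
      omega
    · simp only [reflect, if_neg hfa] at h4 h2 ⊢
      have := hM.nc (f (-a)) (-b) (by omega) (by omega) (by omega) (by omega)
      rw [if_neg (by omega)]
      omega
  · intro i hi
    by_cases hlast : i = n - 1
    · have h1 : (e.tail.map (!·) ++ [false]).getD i true = false := by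
        rw [List.getD_append_right _ _ _ _ (by simp [he]; omega)]
        simp [he, hlast]
      have h2 : (i + 1 : ℤ) = n := by omega
      have hm := hM.mem n (by omega) (by omega)
      have hne := hM.ne n (by omega) (by omega)
      simp only [h1, h2, true_iff, reflect, if_true, if_neg hne]
      omega
    · have h1 : (e.tail.map (!·) ++ [false]).getD i true = !e.getD (i + 1) true := by
        rw [List.getD_append _ _ _ _ (by simp [he]; omega)]
        simp [List.getD_eq_getElem?_getD, he, show i + 1 < n by omega]
      have h2 := h.down (i + 1) (by omega)
      push_cast at h2
      have hr : reflect n ((i : ℤ) + 1) = -(i + 1) := if_neg (by omega)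
      rw [h1, Bool.not_eq_false', h2, hr]
      unfold reflect
      split_ifs <;> omega
  · intro i hi
    rcases i with _ | i
    · simpa using fun hh => le_of_lt hh
    · have h1 : (false :: u.dropLast.map (!·)).getD (i + 1) true = !u.getD i true := by
        rw [List.getD_cons_succ]
        have h2 : i < n - 1 := by omega
        simp [List.getD_eq_getElem?_getD, hu, h2, show i < n by omega]
      have h2 := h.up i (by omega)
      have hr : reflect n (-((i + 1 : ℕ) : ℤ)) = i + 1 := by
        unfold reflect
        rw [if_neg (by omega)]
        push_cast
        ring
      rw [h1, Bool.not_eq_true', h2, hr]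
      push_cast
      unfold reflect
      split_ifs <;> omega

theorem MatchingBits.ext {n : ℕ} {f g : ℤ → ℤ} {u e u' e' : List Bool}
    (h : MatchingBits n f u e) (h' : MatchingBits n g u' e')
    (hfg : ∀ k, 1 - (n : ℤ) ≤ k → k ≤ n → f k = g k) : u = u' ∧ e = e' := by
  have hu := h.length_u
  have he := h.length_e
  have hu' := h'.length_u
  have he' := h'.length_e
  constructor
  · refine List.ext_getElem (by omega) fun i h1 h2 => ?_
    have h3 := h.up i (by omega)
    rw [hfg _ (by omega) (by omega), ← h'.up i (by omega), List.getD_eq_getElem _ _ h1,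
      List.getD_eq_getElem _ _ h2] at h3
    exact Bool.eq_iff_iff.2 (by simpa using not_congr h3)
  · refine List.ext_getElem (by omega) fun i h1 h2 => ?_
    have h3 := h.down i (by omega)
    rw [hfg _ (by omega) (by omega), ← h'.down i (by omega), List.getD_eq_getElem _ _ h1,
      List.getD_eq_getElem _ _ h2] at h3
    exact Bool.eq_iff_iff.2 h3

/-- The Dyck `n`-path `p` corresponds to the noncrossing matching `f`. -/
structure Codes (n : ℕ) (f : ℤ → ℤ) (p : List Bool) : Prop where
  tree : DyckTree p
  count : p.count true = n
  bits : MatchingBits n f (sameNext true p) (samePrev false p)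

theorem Codes.eq {n : ℕ} {f g : ℤ → ℤ} {p q : List Bool} (hn : 1 ≤ n) (hp : Codes n f p)
    (hq : Codes n g q) (hfg : ∀ k, 1 - (n : ℤ) ≤ k → k ≤ n → f k = g k) : p = q := by
  obtain ⟨hu, he⟩ := hp.bits.ext hq.bits hfg
  have hp0 : p ≠ [] := by
    rintro rfl
    have := hp.count
    simp at this
    omega
  have hq0 : q ≠ [] := by
    rintro rfl
    have := hq.count
    simp at this
    omega
  refine eq_of_sameNext_eq ?_ ?_
  · rw [hp.tree.head?.resolve_left hp0, hq.tree.head?.resolve_left hq0]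
  · rintro (_ | _)
    · have h1 := hp.tree.sameNext_samePrev hp0
      rw [he, hq.tree.sameNext_samePrev hq0] at h1
      exact (List.cons.inj h1).2.symm
    · exact hu

/-- Rotation of the cycle `[1 - n, n]`. -/
def rotate (n : ℕ) (k : ℤ) : ℤ := if k = n then 1 - n else k + 1

/-- Inverse rotation of the cycle `[1 - n, n]`. -/
def rotateInv (n : ℕ) (k : ℤ) : ℤ := if k = 1 - n then n else k - 1

theorem Codes.step {n : ℕ} {f : ℤ → ℤ} {p : List Bool} (hn : 1 ≤ n) (h : Codes n f p) :
    Codes n (rotate n ∘ f ∘ rotateInv n) ((pathDeriv Lmap ∘ Lmap) p) := by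
  have hp0 : p ≠ [] := by
    rintro rfl
    have := h.count
    simp at this
    omega
  obtain ⟨ht, hc, hu, he⟩ := h.tree.bits_Lmap hp0
  obtain ⟨ht', hc', hd⟩ := ht.bits_pathDeriv_Lmap
  refine ⟨ht', by rw [Function.comp_apply, hc', hc, h.count], ?_⟩
  have h1 := h.bits.lk hn
  rw [← hu, ← he] at h1
  have h2 := h1.deriv hd
  have hf : (fun k => 1 - reflect n (f (reflect n (1 - k)))) = rotate n ∘ f ∘ rotateInv n := by
    funext k
    have h3 : reflect n (1 - k) = rotateInv n k := by
      unfold reflect rotateInv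
      split_ifs <;> omega
    have h4 : ∀ x, 1 - reflect n x = rotate n x := by
      intro x
      unfold reflect rotate
      split_ifs <;> omega
    rw [h3, h4]
    rfl
  rw [hf] at h2
  exact h2

theorem Codes.iterate {n : ℕ} {f : ℤ → ℤ} {p : List Bool} (hn : 1 ≤ n) (h : Codes n f p) (m : ℕ) :
    Codes n ((rotate n)^[m] ∘ f ∘ (rotateInv n)^[m]) ((pathDeriv Lmap ∘ Lmap)^[m] p) := by
  induction m with
  | zero => exact h
  | succ m ih =>
    have := ih.step hn
    rwa [Function.iterate_succ_apply' (pathDeriv Lmap ∘ Lmap), Function.iterate_succ' (rotate n),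
      Function.iterate_succ (rotateInv n)]

theorem eq_of_two_mul_dvd_sub {n : ℕ} {a b : ℤ} (ha : 1 - (n : ℤ) ≤ a ∧ a ≤ n)
    (hb : 1 - (n : ℤ) ≤ b ∧ b ≤ n) (h : (2 * n : ℤ) ∣ a - b) : a = b := by
  have := Int.eq_zero_of_abs_lt_dvd h (by rw [abs_lt]; omega)
  omega

theorem iterate_rotate {n : ℕ} {k : ℤ} (hk : 1 - (n : ℤ) ≤ k ∧ k ≤ n) (m : ℕ) :
    (1 - (n : ℤ) ≤ (rotate n)^[m] k ∧ (rotate n)^[m] k ≤ n) ∧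
      (2 * n : ℤ) ∣ (rotate n)^[m] k - (k + m) := by
  induction m with
  | zero => simpa using hk
  | succ m ih =>
    rw [Function.iterate_succ_apply']
    obtain ⟨h1, c, hc⟩ := ih
    unfold rotate at h1 hc ⊢
    split_ifs with h
    · exact ⟨by omega, c - 1, by push_cast; linear_combination hc - h⟩
    · exact ⟨by omega, c, by push_cast; linear_combination hc⟩

theorem iterate_rotateInv {n : ℕ} {k : ℤ} (hk : 1 - (n : ℤ) ≤ k ∧ k ≤ n) (m : ℕ) :
    (1 - (n : ℤ) ≤ (rotateInv n)^[m] k ∧ (rotateInv n)^[m] k ≤ n) ∧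
      (2 * n : ℤ) ∣ (rotateInv n)^[m] k - (k - m) := by
  induction m with
  | zero => simpa using hk
  | succ m ih =>
    rw [Function.iterate_succ_apply']
    obtain ⟨h1, c, hc⟩ := ih
    unfold rotateInv at h1 hc ⊢
    split_ifs with h
    · exact ⟨by omega, c + 1, by push_cast; linear_combination hc - h⟩
    · exact ⟨by omega, c, by push_cast; linear_combination hc⟩

theorem DyckTree.exists_codes {p : List Bool} (h : DyckTree p) : ∃ f, Codes (p.count true) f p :=
  h.exists_matchingBits.imp fun _ hf => ⟨h, rfl, hf⟩

theorem Codes.iterate_two_mul {n : ℕ} {f : ℤ → ℤ} {p : List Bool} (hn : 1 ≤ n)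
    (h : Codes n f p) : (pathDeriv Lmap ∘ Lmap)^[2 * n] p = p := by
  refine (h.iterate hn (2 * n)).eq hn h fun k h1 h2 => ?_
  have hrot : ∀ k, 1 - (n : ℤ) ≤ k → k ≤ n → (rotate n)^[2 * n] k = k := by
    intro k h1 h2
    have h3 := iterate_rotate (n := n) ⟨h1, h2⟩ (2 * n)
    refine eq_of_two_mul_dvd_sub h3.1 ⟨h1, h2⟩ ?_
    obtain ⟨c, hc⟩ := h3.2
    exact ⟨c + 1, by push_cast at hc; linear_combination hc⟩
  have hinv : (rotateInv n)^[2 * n] k = k := by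
    have h3 := iterate_rotateInv (n := n) ⟨h1, h2⟩ (2 * n)
    refine eq_of_two_mul_dvd_sub h3.1 ⟨h1, h2⟩ ?_
    obtain ⟨c, hc⟩ := h3.2
    exact ⟨c - 1, by push_cast at hc; linear_combination hc⟩
  have hm := h.bits.matching.mem k h1 h2
  rw [Function.comp_apply, Function.comp_apply, hinv, hrot _ hm.1 hm.2]

theorem MatchingBits.getD_sub_two_eq_true_iff {n : ℕ} {f : ℤ → ℤ} {u e : List Bool}
    (h : MatchingBits n f u e) (hn : 2 ≤ n) : u.getD (n - 2) true = true ↔ f (n - 1) = n := by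
  have hodd := h.matching.odd_sub (k := n - 1) (by omega) (by omega)
  have hm := h.matching.mem (n - 1) (by omega) (by omega)
  have h1 := h.up (n - 2) (by omega)
  rw [show ((n - 2 : ℕ) : ℤ) + 1 = n - 1 by omega] at h1
  rw [← Bool.not_eq_false, h1]
  omega

/-- The path with a single peak. -/
def nestedPath : ℕ → List Bool
  | 0 => []
  | k + 1 => true :: nestedPath k ++ false :: []

/-- The path whose components all have size one. -/
def zigzagPath : ℕ → List Bool
  | 0 => []
  | k + 1 => true :: [] ++ false :: zigzagPath k

theorem dyckTree_nestedPath : ∀ k, DyckTree (nestedPath k)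
  | 0 => .nil
  | k + 1 => .node (dyckTree_nestedPath k) .nil

theorem dyckTree_zigzagPath : ∀ k, DyckTree (zigzagPath k)
  | 0 => .nil
  | k + 1 => .node .nil (dyckTree_zigzagPath k)

theorem count_nestedPath (k : ℕ) : (nestedPath k).count true = k := by
  induction k with
  | zero => rfl
  | succ k ih => simp [nestedPath, ih]

theorem count_zigzagPath (k : ℕ) : (zigzagPath k).count true = k := by
  induction k with
  | zero => rfl
  | succ k ih => simp [zigzagPath, ih]

theorem sameNext_nestedPath (k : ℕ) :
    sameNext true (nestedPath (k + 1)) = List.replicate k true ++ [false] := by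
  induction k with
  | zero => rfl
  | succ k ih =>
    rw [nestedPath, sameNext_node (dyckTree_nestedPath _), ih]
    simp [nestedPath, List.replicate_succ, sameNext]

theorem samePrev_nestedPath (k : ℕ) :
    samePrev false (nestedPath (k + 1)) = false :: List.replicate k true := by
  induction k with
  | zero => rfl
  | succ k ih =>
    rw [nestedPath, samePrev_node (dyckTree_nestedPath _) .nil, ih]
    simp [nestedPath, List.replicate_succ', samePrev]

theorem sameNext_zigzagPath (k : ℕ) :
    sameNext true (zigzagPath k) = List.replicate k false := by
  induction k with
  | zero => rfl
  | succ k ih =>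
    rw [zigzagPath, sameNext_node .nil, ih]
    simp [List.replicate_succ, sameNext]

theorem Codes.getD_iterate_eq_true_iff {n : ℕ} {f : ℤ → ℤ} {p : List Bool} (hn : 2 ≤ n)
    (h : Codes n f p) (m : ℕ) :
    (sameNext true ((pathDeriv Lmap ∘ Lmap)^[m] p)).getD (n - 2) true = true ↔
      ∃ x, (1 - (n : ℤ) ≤ x ∧ x ≤ n) ∧ (2 * n : ℤ) ∣ x + 1 + m - n ∧ f x = rotate n x := by
  rw [(h.iterate (by omega) m).bits.getD_sub_two_eq_true_iff hn, Function.comp_apply,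
    Function.comp_apply]
  obtain ⟨hx, hxd⟩ := iterate_rotateInv (n := n) (k := n - 1) (by omega) m
  generalize (rotateInv n)^[m] (n - 1) = x at hx hxd ⊢
  obtain ⟨hy, hyd⟩ := iterate_rotate (h.bits.matching.mem x hx.1 hx.2) m
  obtain ⟨hr, hrd⟩ := iterate_rotate (n := n) hx 1
  rw [Function.iterate_one] at hr hrd
  have hfx := h.bits.matching.mem x hx.1 hx.2
  obtain ⟨c, hc⟩ := hxd
  obtain ⟨d, hd⟩ := hyd
  obtain ⟨r, hr'⟩ := hrd
  constructor
  · intro heq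
    rw [heq] at hd
    refine ⟨x, hx, ⟨c, by linear_combination hc⟩, eq_of_two_mul_dvd_sub hfx hr ?_⟩
    exact ⟨-c - d - r, by push_cast at hr'; linear_combination - hc - hd - hr'⟩
  · rintro ⟨z, hz, ⟨t, ht⟩, hfz⟩
    have hzx : z = x := eq_of_two_mul_dvd_sub hz hx ⟨t - c, by linear_combination ht - hc⟩
    subst hzx
    refine eq_of_two_mul_dvd_sub hy (by omega) ⟨d + r + t, ?_⟩
    rw [hfz] at hd ⊢
    push_cast at hr'
    linear_combination hd + hr' + ht

theorem eq_of_iterate_nestedPath {n m : ℕ} (hn : 3 ≤ n) (hm : 0 < m) (hm2 : m < 2 * n)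
    (h : (pathDeriv Lmap ∘ Lmap)^[m] (nestedPath n) = nestedPath n) : m = n := by
  obtain ⟨f, hf⟩ := (dyckTree_nestedPath n).exists_codes
  rw [count_nestedPath] at hf
  have hM := hf.bits.matching
  have hu : ∀ i < n, ((sameNext true (nestedPath n)).getD i true = true ↔ i < n - 1) := by
    intro i hi
    obtain ⟨k, rfl⟩ : ∃ k, n = k + 1 := ⟨n - 1, by omega⟩
    rw [sameNext_nestedPath, List.getD_eq_getElem _ _ (by simpa using hi), List.getElem_append]
    split_ifs with h1 <;> simp at h1 ⊢ <;> omega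
  have he : ∀ i < n, ((samePrev false (nestedPath n)).getD i true = true ↔ 0 < i) := by
    intro i hi
    obtain ⟨k, rfl⟩ : ∃ k, n = k + 1 := ⟨n - 1, by omega⟩
    rw [samePrev_nestedPath, List.getD_eq_getElem _ _ (by simpa using hi)]
    rcases i with _ | i <;> simp
  have hun := (hu (n - 2) (by omega)).2 (by omega)
  have hfn := (hf.bits.getD_sub_two_eq_true_iff (by omega)).1 hun
  have hfn' := hM.invol (n - 1) (by omega) (by omega)
  rw [hfn] at hfn'
  rw [← h, hf.getD_iterate_eq_true_iff (by omega)] at hun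
  obtain ⟨x, hx, hd, hfx⟩ := hun
  have hxn : x ≠ n := by
    rintro rfl
    rw [hfn', rotate, if_pos rfl] at hfx
    omega
  rw [rotate, if_neg hxn] at hfx
  have hinv := hM.invol x hx.1 hx.2
  rw [hfx] at hinv
  rcases lt_or_ge x 0 with hneg | hpos
  · obtain ⟨i, hi⟩ : ∃ i : ℕ, x = -i - 1 := ⟨(-x - 1).toNat, by omega⟩
    have h1 := hf.bits.down i (by omega)
    rw [he i (by omega), show -(i : ℤ) = x + 1 by omega, hinv] at h1
    have h2 : x = -1 := by omega
    have h3 := Int.eq_zero_of_abs_lt_dvd hd (by rw [abs_lt]; omega)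
    omega
  · obtain ⟨i, rfl⟩ := Int.eq_ofNat_of_zero_le hpos
    have h1 := hf.bits.up i (by omega)
    rw [hinv, ← Bool.not_eq_true, hu i (by omega)] at h1
    have h2 : i = n - 1 := by omega
    have h3 := Int.eq_zero_of_abs_lt_dvd (x := m) (m := 2 * n)
      (by convert hd using 1; omega) (by rw [abs_lt]; omega)
    omega

theorem exists_iterate_half_ne {n : ℕ} (hn : 3 ≤ n) :
    ∃ p, DyckTree p ∧ p.count true = n ∧ (pathDeriv Lmap ∘ Lmap)^[n] p ≠ p := by
  obtain ⟨k, rfl⟩ : ∃ k, n = k + 3 := ⟨n - 3, by omega⟩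
  have hq : DyckTree (zigzagPath 1) := dyckTree_zigzagPath 1
  have hr : DyckTree (zigzagPath (k + 1)) := dyckTree_zigzagPath (k + 1)
  have hp : DyckTree (true :: zigzagPath 1 ++ false :: zigzagPath (k + 1)) := .node hq hr
  have hc : (true :: zigzagPath 1 ++ false :: zigzagPath (k + 1)).count true = k + 3 := by
    simp [count_zigzagPath]
    omega
  refine ⟨_, hp, hc, fun heq => ?_⟩
  obtain ⟨f, hf⟩ := hp.exists_codes
  rw [hc] at hf
  have hdown := (hf.bits.down 1 (by omega)).1 (by rw [samePrev_node hq hr]; rfl)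
  have h1 := (hf.getD_iterate_eq_true_iff (by omega) (k + 3)).2
    ⟨-1, by omega, by simp, by rw [rotate, if_neg (by omega)]; push_cast at hdown; omega⟩
  rw [heq, sameNext_node hq, sameNext_zigzagPath, sameNext_zigzagPath] at h1
  simp [List.getD_eq_getElem?_getD, List.getElem_cons] at h1

/-- For every `n ≥ 3`, the permutation `L' ∘ L` of the finite set of Dyck `n`-paths has
order exactly `2 n`: `2 n` is the least positive `m` such that the `m`-th iterate of
`L' ∘ L` is the identity on Dyck `n`-paths. -/
theorem orderOf_lkDeriv_comp_lk (n : ℕ) (hn : 3 ≤ n) :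
    IsLeast {m : ℕ | 0 < m ∧ ∀ p : List Bool, IsDyckN n p →
      (pathDeriv Lmap ∘ Lmap)^[m] p = p} (2 * n) := by
  refine ⟨⟨by omega, fun p hp => ?_⟩, fun m ⟨hm, h⟩ => ?_⟩
  · obtain ⟨f, hf⟩ := ((isDyck_iff_dyckTree p).1 hp.1).exists_codes
    rw [hp.2] at hf
    exact hf.iterate_two_mul (by omega)
  · by_contra hlt
    have hnested := h (nestedPath n)
      ⟨(isDyck_iff_dyckTree _).2 (dyckTree_nestedPath n), count_nestedPath n⟩
    obtain rfl := eq_of_iterate_nestedPath hn hm (by omega) hnested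
    obtain ⟨p, hp, hc, hne⟩ := exists_iterate_half_ne hn
    exact hne (h p ⟨(isDyck_iff_dyckTree p).2 hp, hc⟩)
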